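/- Suppose the social welfare function Φ satisfies restricted monotonicity and no belief imposition. Let p ∈ R̄^I be such that Φ(p) is not complete indifference and p has belief dimension at least 3. Then there are distinct concerned agents i, j ∈ I_p such that φ(p_{∼{i,j}}), π_i, and π_j are affinely independent. -/

import Mathlib

open MeasureTheory

/-- An act: a measurable map from states to outcomes. -/
abbrev Act (Ω O : Type*) [MeasurableSpace Ω] [MeasurableSpace O] : Type _ :=
  {f : Ω → O // Measurable f}

/-- Non-atomicity of a measure relative to an explicit σ-algebra `m'`:
for every `m'`-measurable set of positive measure there is an `m'`-measurable
subset of strictly smaller positive measure. -/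
def NonatomicOn {Ω : Type*} [MeasurableSpace Ω] (π : MeasureTheory.Measure Ω)
    (m' : MeasurableSpace Ω) : Prop :=
  ∀ E : Set Ω, MeasurableSet[m'] E → 0 < π E →
    ∃ F : Set Ω, MeasurableSet[m'] F ∧ F ⊆ E ∧ 0 < π F ∧ π F < π E

section Framework

variable {Ω O I : Type*} [mΩ : MeasurableSpace Ω] [mO : MeasurableSpace O]

/-- A belief: a non-atomic (countably additive) probability measure. -/
def IsBelief (π : Measure Ω) : Prop :=
  IsProbabilityMeasure π ∧ NonatomicOn π mΩ

/-- A utility function: a bounded measurable function on outcomes. -/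
def IsUtility (u : O → ℝ) : Prop :=
  Measurable u ∧ ∃ M : ℝ, ∀ x, |u x| ≤ M

/-- A normalized utility function: measurable with infimum 0 and supremum 1. -/
def NormalizedUtility (u : O → ℝ) : Prop :=
  Measurable u ∧ IsGLB (Set.range u) 0 ∧ IsLUB (Set.range u) 1

/-- Member of `𝒰̄`: normalized or identically zero. -/
def NormalizedUtilityBar (u : O → ℝ) : Prop :=
  NormalizedUtility u ∨ u = 0

/-- Subjective expected utility of an act. -/
noncomputable def ev (π : Measure Ω) (u : O → ℝ) (f : Act Ω O) : ℝ :=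
  ∫ ω, u (f.1 ω) ∂π

/-- Preference relations over acts. -/
abbrev Pref (Ω O : Type*) [MeasurableSpace Ω] [MeasurableSpace O] :=
  Act Ω O → Act Ω O → Prop

/-- `(π, u)` represents `r`: `f ≿ g` iff the expected utility of `f` is at least
that of `g`. -/
def Represents (π : Measure Ω) (u : O → ℝ) (r : Pref Ω O) : Prop :=
  ∀ f g : Act Ω O, r f g ↔ ev π u g ≤ ev π u f

/-- A normalized representation: a belief together with a normalized (or zero)
utility function representing the relation. -/
def NormRep (π : Measure Ω) (u : O → ℝ) (r : Pref Ω O) : Prop :=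
  IsBelief π ∧ NormalizedUtilityBar u ∧ Represents π u r

/-- Membership in `R̄`: the relation maximizes subjective expected utility. -/
def IsSEU (r : Pref Ω O) : Prop :=
  ∃ (π : Measure Ω) (u : O → ℝ), IsBelief π ∧ IsUtility u ∧ Represents π u r

/-- Complete indifference: the relation with empty strict part. -/
def CompletelyIndifferent (r : Pref Ω O) : Prop :=
  ∀ f g : Act Ω O, r f g

/-- `π` is a belief representing `r` (together with some utility function). -/
def RepresentsBelief (π : Measure Ω) (r : Pref Ω O) : Prop :=
  IsBelief π ∧ ∃ u : O → ℝ, IsUtility u ∧ Represents π u r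

/-- A preference profile: every agent's relation is SEU-maximizing. -/
def IsProfile (p : I → Pref Ω O) : Prop := ∀ i, IsSEU (p i)

/-- The completely indifferent relation. -/
def indiffRel : Pref Ω O := fun _ _ => True

open Classical in
/-- `p_{∼i}`: replace agent `i`'s relation by complete indifference. -/
noncomputable def updIndiff (p : I → Pref Ω O) (i : I) : I → Pref Ω O :=
  fun j => if j = i then indiffRel else p j

/-- `p_{∼{i,j}}`. -/
noncomputable def updIndiffPair (p : I → Pref Ω O) (i j : I) : I → Pref Ω O :=
  updIndiff (updIndiff p i) j

open Classical in
/-- `I_p`: the set of concerned agents. -/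
noncomputable def concerned [Fintype I] (p : I → Pref Ω O) : Finset I :=
  Finset.univ.filter fun i => ¬ CompletelyIndifferent (p i)

/-- Equivalence of utility functions: equality up to a positive affine
transformation. -/
def UEquiv (u v : O → ℝ) : Prop :=
  ∃ a : ℝ, 0 < a ∧ ∃ b : ℝ, ∀ x, u x = a * v x + b

/-- The beliefs `(πa i)_{i ∈ J}` are affinely independent. -/
def BeliefsAffIndep (J : Finset I) (πa : I → Measure Ω) : Prop :=
  ∀ c : I → ℝ, (∑ i ∈ J, c i) = 0 →
    (∀ E : Set Ω, MeasurableSet E → (∑ i ∈ J, c i * (πa i E).toReal) = 0) →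
    ∀ i ∈ J, c i = 0

/-- The utility functions `(ua i)_{i ∈ J}` are linearly independent: no
nontrivial linear combination of them is a constant function. -/
def UtilsLinIndep (J : Finset I) (ua : I → O → ℝ) : Prop :=
  ∀ c : I → ℝ, (∃ b : ℝ, ∀ x, (∑ i ∈ J, c i * ua i x) = b) → ∀ i ∈ J, c i = 0

/-- The profile has non-degenerate beliefs: the beliefs of any pair and any
triple of concerned agents are affinely independent. -/
def NonDegenerateBeliefs [Fintype I] (p : I → Pref Ω O) (πa : I → Measure Ω) : Prop :=
  ∀ J : Finset I, J ⊆ concerned p → (J.card = 2 ∨ J.card = 3) → BeliefsAffIndep J πa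

/-- The profile has non-degenerate utilities: the utility functions of any pair
and any triple of concerned agents are linearly independent. -/
def NonDegenerateUtils [Fintype I] (p : I → Pref Ω O) (ua : I → O → ℝ) : Prop :=
  ∀ J : Finset I, J ⊆ concerned p → (J.card = 2 ∨ J.card = 3) → UtilsLinIndep J ua

/-- The belief dimension of the beliefs `(πa i)_{i ∈ J}` is at least `n`. -/
def BeliefDimAtLeast (n : ℕ) (J : Finset I) (πa : I → Measure Ω) : Prop :=
  ∃ E : Fin n → Set Ω, (∀ k, MeasurableSet (E k)) ∧
    ∀ c : Fin n → ℝ, (∀ i ∈ J, (∑ k, c k * (πa i (E k)).toReal) = 0) → ∀ k, c k = 0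

/-- The utility dimension of the utility functions `(ua i)_{i ∈ J}` is at
least `n`. -/
def UtilDimAtLeast (n : ℕ) (J : Finset I) (ua : I → O → ℝ) : Prop :=
  ∃ q : Fin n → Measure O, (∀ k, IsProbabilityMeasure (q k)) ∧
    ∀ c : Fin n → ℝ, (∀ i ∈ J, (∑ k, c k * ∫ x, ua i x ∂(q k)) = 0) → ∀ k, c k = 0

open Classical in
/-- The expected utility function of an SEU relation (via a choice of a
normalized representation). -/
noncomputable def evOf (r : Pref Ω O) : Act Ω O → ℝ :=
  if h : ∃ π : Measure Ω, ∃ u : O → ℝ, NormRep π u r then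
    fun f => ev h.choose h.choose_spec.choose f
  else fun _ => 0

/-- The uniform metric on `R`. -/
noncomputable def prefDist (r r' : Pref Ω O) : ℝ :=
  ⨆ f : Act Ω O, |evOf r f - evOf r' f|

/-- Continuity of a real-valued function on `R` with respect to the uniform
metric. -/
def ContOnR (h : Pref Ω O → ℝ) : Prop :=
  ∀ r : Pref Ω O, IsSEU r → ¬ CompletelyIndifferent r →
    ∀ ε : ℝ, 0 < ε → ∃ δ : ℝ, 0 < δ ∧
      ∀ r' : Pref Ω O, IsSEU r' → ¬ CompletelyIndifferent r' →
        prefDist r r' < δ → |h r' - h r| < ε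

/-- Open sets of `R̄`: the whole space `R̄` together with the metrically open
subsets of `R`. -/
def OpenInRbar (S : Set (Pref Ω O)) : Prop :=
  S = {r | IsSEU r} ∨
    ∀ r ∈ S, IsSEU r ∧ ¬ CompletelyIndifferent r ∧
      ∃ ε : ℝ, 0 < ε ∧ ∀ r' : Pref Ω O, IsSEU r' → ¬ CompletelyIndifferent r' →
        prefDist r r' < ε → r' ∈ S

/-- Restricted monotonicity (on a domain `D` of profiles). -/
def RestrictedMonotonicityOn (D : (I → Pref Ω O) → Prop)
    (Φ : (I → Pref Ω O) → Pref Ω O) : Prop :=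
  ∀ (i : I) (p : I → Pref Ω O), D p →
    ∀ πsi πi : Measure Ω,
      RepresentsBelief πsi (Φ (updIndiff p i)) → RepresentsBelief πi (p i) →
      ∀ f g : Act Ω O,
        Φ (updIndiff p i) f g → Φ (updIndiff p i) g f →
        Measure.map f.1 πsi = Measure.map f.1 πi →
        Measure.map g.1 πsi = Measure.map g.1 πi →
        (p i f g → Φ p f g) ∧ ((p i f g ∧ ¬ p i g f) → (Φ p f g ∧ ¬ Φ p g f))

abbrev RestrictedMonotonicity (Φ : (I → Pref Ω O) → Pref Ω O) : Prop :=
  RestrictedMonotonicityOn IsProfile Φ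

/-- Faithfulness (on a domain `D`). -/
def FaithfulOn (D : (I → Pref Ω O) → Prop) (Φ : (I → Pref Ω O) → Pref Ω O) : Prop :=
  ∀ p : I → Pref Ω O, D p → (∀ i, CompletelyIndifferent (p i)) →
    CompletelyIndifferent (Φ p)

abbrev Faithful (Φ : (I → Pref Ω O) → Pref Ω O) : Prop := FaithfulOn IsProfile Φ

/-- No belief imposition (on a domain `D`). -/
def NoBeliefImpositionOn (D : (I → Pref Ω O) → Prop)
    (Φ : (I → Pref Ω O) → Pref Ω O) : Prop :=
  ∀ (i : I) (p : I → Pref Ω O), D p →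
    ¬ CompletelyIndifferent (Φ (updIndiff p i)) →
    ¬ CompletelyIndifferent (Φ p) →
    ¬ CompletelyIndifferent (p i) →
    ∀ πsi π πi : Measure Ω,
      RepresentsBelief πsi (Φ (updIndiff p i)) →
      RepresentsBelief π (Φ p) → RepresentsBelief πi (p i) →
      πsi ≠ πi → π ≠ πi

abbrev NoBeliefImposition (Φ : (I → Pref Ω O) → Pref Ω O) : Prop :=
  NoBeliefImpositionOn IsProfile Φ

/-- Continuity of an SWF (on a domain `D`), with respect to the topology of
`R̄` and the product topology on profiles. -/
def ContinuousSWFOn (D : (I → Pref Ω O) → Prop)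
    (Φ : (I → Pref Ω O) → Pref Ω O) : Prop :=
  ∀ S : Set (Pref Ω O), OpenInRbar S →
    ∀ p : I → Pref Ω O, D p → Φ p ∈ S →
      ∃ T : I → Set (Pref Ω O), (∀ i, OpenInRbar (T i)) ∧ (∀ i, p i ∈ T i) ∧
        ∀ q : I → Pref Ω O, D q → (∀ i, q i ∈ T i) → Φ q ∈ S

abbrev ContinuousSWF (Φ : (I → Pref Ω O) → Pref Ω O) : Prop :=
  ContinuousSWFOn IsProfile Φ

/-- Anonymity (on a domain `D`). -/
def AnonymousOn (D : (I → Pref Ω O) → Prop)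
    (Φ : (I → Pref Ω O) → Pref Ω O) : Prop :=
  ∀ p : I → Pref Ω O, D p → ∀ η : Equiv.Perm I, Φ (fun i => p (η i)) = Φ p

abbrev Anonymous (Φ : (I → Pref Ω O) → Pref Ω O) : Prop := AnonymousOn IsProfile Φ

/-- The regular set of acts `𝒜(ℰ', O')`. -/
def RegularActs (m' : MeasurableSpace Ω) (O' : Set O) : Set (@Act Ω O mΩ mO) :=
  {f : @Act Ω O mΩ mO | @Measurable Ω O m' mO f.1 ∧ Set.range f.1 ⊆ O'}

/-- `𝒜(ℰ', O')` is co-redundant for `p` (with representing beliefs `πa`). -/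
def CoRedundant (m' : MeasurableSpace Ω) (O' : Set O)
    (p : I → @Pref Ω O mΩ mO) (πa : I → @MeasureTheory.Measure Ω mΩ) : Prop :=
  (∀ f : @Act Ω O mΩ mO, ∃ g ∈ @RegularActs Ω O mΩ mO m' O', ∀ i, p i f g ∧ p i g f) ∧
  (∀ i, @NonatomicOn Ω mΩ (πa i) m')

/-- Independence of redundant acts (on a domain `D`). -/
def IndepRedundantActsOn (D : (I → Pref Ω O) → Prop)
    (Φ : (I → Pref Ω O) → Pref Ω O) : Prop :=
  ∀ (p p' : I → Pref Ω O) (πa πa' : I → Measure Ω),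
    D p → D p' →
    (∀ i, RepresentsBelief (πa i) (p i)) →
    (∀ i, RepresentsBelief (πa' i) (p' i)) →
    ∀ (m' : {m : MeasurableSpace Ω // m ≤ mΩ}) (O' : Set O),
      CoRedundant m'.1 O' p πa → CoRedundant m'.1 O' p' πa' →
      (∀ i : I, ∀ f ∈ RegularActs m'.1 O', ∀ g ∈ RegularActs m'.1 O',
        (p i f g ↔ p' i f g)) →
      ∀ f ∈ RegularActs m'.1 O', ∀ g ∈ RegularActs m'.1 O',
        (Φ p f g ↔ Φ p' f g)

abbrev IndepRedundantActs (Φ : (I → Pref Ω O) → Pref Ω O) : Prop :=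
  IndepRedundantActsOn IsProfile Φ

/-- The weighted average of the concerned agents' beliefs with weights `v`. -/
noncomputable def mixBelief [Fintype I] (p : I → Pref Ω O) (πa : I → Measure Ω)
    (v : I → ℝ) : Measure Ω :=
  (ENNReal.ofReal ((∑ i ∈ concerned p, v i)⁻¹)) •
    ∑ i ∈ concerned p, ENNReal.ofReal (v i) • πa i

/-- The weighted sum of the concerned agents' utility functions with weights
`w`. -/
noncomputable def mixUtil [Fintype I] (p : I → Pref Ω O) (ua : I → O → ℝ)
    (w : I → ℝ) : O → ℝ :=
  fun x => ∑ i ∈ concerned p, w i * ua i x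

/-- A common utility profile: every concerned agent's normalized utility
function is equivalent to `u` or to `-u` for a single `u ∈ 𝒰`. -/
def CommonUtilityProfile [Fintype I] (p : I → Pref Ω O) (ua : I → O → ℝ) : Prop :=
  ∃ u : O → ℝ, NormalizedUtility u ∧
    ∀ i ∈ concerned p, UEquiv (ua i) u ∨ UEquiv (ua i) (fun x => - u x)

end Framework

section Helpers

variable {Ω O : Type*} [MeasurableSpace Ω] [MeasurableSpace O]

/-- Small subsets of positive measure exist for non-atomic measures. -/
lemma nonatomic_small (l : Measure Ω) [IsFiniteMeasure l]
    (hl : ∀ E, MeasurableSet E → 0 < l.real E →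
      ∃ F, MeasurableSet F ∧ F ⊆ E ∧ 0 < l.real F ∧ l.real F < l.real E)
    (A : Set Ω) (hA : MeasurableSet A) (hpos : 0 < l.real A) (e : ℝ) (he : 0 < e) :
    ∃ B, MeasurableSet B ∧ B ⊆ A ∧ 0 < l.real B ∧ l.real B ≤ e := by
  have key : ∀ n : ℕ, ∃ B, MeasurableSet B ∧ B ⊆ A ∧ 0 < l.real B ∧
      l.real B ≤ l.real A * (1/2)^n := by
    intro n
    induction n with
    | zero => exact ⟨A, hA, subset_rfl, hpos, by simp⟩
    | succ n ih =>
      obtain ⟨B, hB, hBA, hB0, hBn⟩ := ih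
      obtain ⟨F, hF, hFB, hF0, hFl⟩ := hl B hB hB0
      have hd : l.real (B \ F) = l.real B - l.real F := measureReal_sdiff hFB hF
      have hp : l.real A * (1/2)^(n+1) = l.real A * (1/2)^n / 2 := by ring
      rcases le_total (l.real F) (l.real B / 2) with h | h
      · exact ⟨F, hF, hFB.trans hBA, hF0, by rw [hp]; linarith⟩
      · exact ⟨B \ F, hB.diff hF, Set.sdiff_subset.trans hBA, by rw [hd]; linarith,
          by rw [hp, hd]; linarith⟩
  obtain ⟨n, hn⟩ := exists_pow_lt_of_lt_one (div_pos he hpos) (by norm_num : (1/2:ℝ) < 1)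
  obtain ⟨B, h1, h2, h3, h4⟩ := key n
  refine ⟨B, h1, h2, h3, h4.trans ?_⟩
  rw [lt_div_iff₀ hpos] at hn
  linarith

/-- Sierpinski theorem on non-atomic measures. -/
lemma sierpinski (l : Measure Ω) [IsFiniteMeasure l]
    (hl : ∀ E, MeasurableSet E → 0 < l.real E →
      ∃ F, MeasurableSet F ∧ F ⊆ E ∧ 0 < l.real F ∧ l.real F < l.real E)
    (A : Set Ω) (hA : MeasurableSet A) (t : ℝ) (ht0 : 0 ≤ t) (ht : t ≤ l.real A) :
    ∃ B, MeasurableSet B ∧ B ⊆ A ∧ l.real B = t := by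
  classical
  let P : Set Ω → Prop := fun B => MeasurableSet B ∧ B ⊆ A ∧ l.real B ≤ t
  have step : ∀ B : {B // P B}, ∃ B' : {B // P B}, B.1 ⊆ B'.1 ∧
      ∀ C, P C → B.1 ⊆ C → l.real C - l.real B.1 ≤ 2 * (l.real B'.1 - l.real B.1) := by
    rintro ⟨B, hB⟩
    let V : Set ℝ := (fun C => l.real C) '' {C | P C ∧ B ⊆ C}
    have hne : V.Nonempty := ⟨_, B, ⟨hB, subset_rfl⟩, rfl⟩
    have hbd : BddAbove V := ⟨t, by rintro _ ⟨C, ⟨hC, _⟩, rfl⟩; exact hC.2.2⟩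
    have hB' : l.real B ≤ sSup V := le_csSup hbd ⟨B, ⟨hB, subset_rfl⟩, rfl⟩
    rcases hB'.eq_or_lt with h | h
    · refine ⟨⟨B, hB⟩, subset_rfl, fun C hC hBC => ?_⟩
      have : l.real C ≤ sSup V := le_csSup hbd ⟨C, ⟨hC, hBC⟩, rfl⟩
      simp only
      linarith
    · obtain ⟨_, ⟨C', ⟨hC', hBC'⟩, rfl⟩, hlt⟩ :=
        exists_lt_of_lt_csSup hne (show (l.real B + sSup V) / 2 < sSup V by linarith)
      refine ⟨⟨C', hC'⟩, hBC', fun C hC hBC => ?_⟩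
      have : l.real C ≤ sSup V := le_csSup hbd ⟨C, ⟨hC, hBC⟩, rfl⟩
      simp only at hlt ⊢
      linarith
  choose nx hnx1 hnx2 using step
  let b0 : {B // P B} := ⟨∅, MeasurableSet.empty, Set.empty_subset _, by simpa using ht0⟩
  let b : ℕ → {B // P B} := fun n => nx^[n] b0
  have hbs : ∀ n, b (n+1) = nx (b n) := fun n => Function.iterate_succ_apply' nx n b0
  have hmono : Monotone (fun n => (b n).1) := by
    apply monotone_nat_of_le_succ
    intro n
    simp only [hbs]
    exact hnx1 _
  have hU : MeasurableSet (⋃ n, (b n).1) := MeasurableSet.iUnion fun n => (b n).2.1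
  have hUA : (⋃ n, (b n).1) ⊆ A := Set.iUnion_subset fun n => (b n).2.2.1
  have hlim : Filter.Tendsto (fun n => l.real (b n).1) Filter.atTop
      (nhds (l.real (⋃ n, (b n).1))) := by
    have h := tendsto_measure_iUnion_atTop (μ := l) hmono
    exact (ENNReal.tendsto_toReal (measure_ne_top _ _)).comp h
  have hUt : l.real (⋃ n, (b n).1) ≤ t := le_of_tendsto' hlim fun n => (b n).2.2.2
  refine ⟨_, hU, hUA, ?_⟩
  by_contra hne
  have hlt : l.real (⋃ n, (b n).1) < t := lt_of_le_of_ne hUt hne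
  have hd : l.real (A \ ⋃ n, (b n).1) = l.real A - l.real (⋃ n, (b n).1) :=
    measureReal_sdiff hUA hU
  obtain ⟨C, hC, hCA, hC0, hCe⟩ := nonatomic_small l hl (A \ ⋃ n, (b n).1) (hA.diff hU)
    (by rw [hd]; linarith) (t - l.real (⋃ n, (b n).1)) (by linarith)
  have hdisj : Disjoint (⋃ n, (b n).1) C :=
    (Set.disjoint_sdiff_right).mono_right hCA
  have hun : l.real ((⋃ n, (b n).1) ∪ C) = l.real (⋃ n, (b n).1) + l.real C :=
    measureReal_union hdisj hC
  have hPD : P ((⋃ n, (b n).1) ∪ C) :=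
    ⟨hU.union hC, Set.union_subset hUA (hCA.trans Set.sdiff_subset), by rw [hun]; linarith⟩
  have hbound : ∀ n, l.real C ≤ 2 * (l.real (b (n+1)).1 - l.real (b n).1) := by
    intro n
    have h1 := hnx2 (b n) _ hPD ((Set.subset_iUnion (fun n => (b n).1) n).trans
      Set.subset_union_left)
    have h2 : l.real (b n).1 ≤ l.real (⋃ n, (b n).1) :=
      measureReal_mono (Set.subset_iUnion (fun n => (b n).1) n)
    rw [hbs]
    linarith
  have hlim2 : Filter.Tendsto (fun n => 2 * (l.real (b (n+1)).1 - l.real (b n).1))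
      Filter.atTop (nhds (2 * (l.real (⋃ n, (b n).1) - l.real (⋃ n, (b n).1)))) :=
    ((hlim.comp (Filter.tendsto_add_atTop_nat 1)).sub hlim).const_mul 2
  have := ge_of_tendsto' hlim2 hbound
  linarith

/-- Simultaneous halving for a family of measures. -/
def Halving (S : Set (Measure Ω)) : Prop :=
  ∀ A, MeasurableSet A → ∃ B, MeasurableSet B ∧ B ⊆ A ∧ ∀ m ∈ S, m.real B = m.real A / 2

lemma Halving.chain {S : Set (Measure Ω)} (hS : Halving S) (hfin : ∀ m ∈ S, IsFiniteMeasure m)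
    (A : Set Ω) (hA : MeasurableSet A) :
    ∃ c : ℝ → Set Ω, (∀ s t, s ≤ t → c s ⊆ c t) ∧ (∀ t, MeasurableSet (c t)) ∧
      (∀ t, t ∈ Set.Icc (0:ℝ) 1 → c t ⊆ A) ∧
      ∀ t, t ∈ Set.Icc (0:ℝ) 1 → ∀ m ∈ S, m.real (c t) = t * m.real A := by
  classical
  have step : ∀ d : {d : ℕ → Set Ω // Monotone d ∧ ∀ k, MeasurableSet (d k)},
      ∃ d' : {d : ℕ → Set Ω // Monotone d ∧ ∀ k, MeasurableSet (d k)},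
        (∀ k, d'.1 (2*k) = d.1 k) ∧ ∀ k, ∀ m ∈ S,
          m.real (d'.1 (2*k+1)) = (m.real (d.1 k) + m.real (d.1 (k+1))) / 2 := by
    rintro ⟨d, hd, hdm⟩
    have h : ∀ k, ∃ B, MeasurableSet B ∧ d k ⊆ B ∧ B ⊆ d (k+1) ∧
        ∀ m ∈ S, m.real B = (m.real (d k) + m.real (d (k+1))) / 2 := by
      intro k
      obtain ⟨B, hB, hBs, hBm⟩ := hS (d (k+1) \ d k) ((hdm _).diff (hdm _))
      have hk : d k ⊆ d (k+1) := hd (Nat.le_succ k)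
      refine ⟨d k ∪ B, (hdm k).union hB, Set.subset_union_left,
        Set.union_subset hk (hBs.trans Set.sdiff_subset), fun m hm => ?_⟩
      have := hfin m hm
      rw [measureReal_union ((Set.disjoint_sdiff_right).mono_right hBs) hB, hBm m hm,
        measureReal_sdiff hk (hdm k)]
      ring
    choose B hB1 hB2 hB3 hB4 using h
    have e1 : ∀ k, (if (2*k) % 2 = 0 then d ((2*k)/2) else B ((2*k)/2)) = d k := by
      intro k
      rw [if_pos (by omega)]; congr 1; omega
    have e2 : ∀ k, (if (2*k+1) % 2 = 0 then d ((2*k+1)/2) else B ((2*k+1)/2)) = B k := by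
      intro k
      rw [if_neg (by omega)]; congr 1; omega
    refine ⟨⟨fun n => if n % 2 = 0 then d (n/2) else B (n/2), ?_, ?_⟩, ?_, ?_⟩
    · apply monotone_nat_of_le_succ
      intro n
      rcases Nat.even_or_odd' n with ⟨k, rfl | rfl⟩
      · simp only [e1, e2]; exact hB2 k
      · have : 2*k+1+1 = 2*(k+1) := by ring
        simp only [this, e1, e2]; exact hB3 k
    · intro n
      simp only
      split_ifs
      · exact hdm _
      · exact hB1 _
    · intro k; exact e1 k
    · intro k m hm
      simp only [e2]; exact hB4 k m hm
  choose nx hnx1 hnx2 using step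
  let d0 : {d : ℕ → Set Ω // Monotone d ∧ ∀ k, MeasurableSet (d k)} :=
    ⟨fun k => if k = 0 then ∅ else A, by
      apply monotone_nat_of_le_succ
      intro n
      by_cases h : n = 0
      · simp [h]
      · simp [h], by
      intro k
      simp only
      split_ifs
      · exact MeasurableSet.empty
      · exact hA⟩
  let d : ℕ → {d : ℕ → Set Ω // Monotone d ∧ ∀ k, MeasurableSet (d k)} := fun n => nx^[n] d0
  have hds : ∀ n, d (n+1) = nx (d n) := fun n => Function.iterate_succ_apply' nx n d0
  have hval : ∀ n, ∀ k ≤ 2^n, ∀ m ∈ S, m.real ((d n).1 k) = (k:ℝ) / 2^n * m.real A := by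
    intro n
    induction n with
    | zero =>
      intro k hk m hm
      have : k = 0 ∨ k = 1 := by simp at hk; omega
      rcases this with rfl | rfl
      · simp [d, d0]
      · simp [d, d0]
    | succ n ih =>
      intro k hk m hm
      rw [hds]
      rcases Nat.even_or_odd' k with ⟨j, rfl | rfl⟩
      · rw [hnx1, ih j (by rw [pow_succ] at hk; omega) m hm]
        push_cast; field_simp; ring
      · rw [hnx2 _ _ m hm, ih j (by rw [pow_succ] at hk; omega) m hm,
          ih (j+1) (by rw [pow_succ] at hk; omega) m hm]
        push_cast; field_simp; ring
  have htop : ∀ n, ∀ k ≤ 2^n, (d n).1 k ⊆ A := by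
    have : ∀ n, (d n).1 (2^n) = A := by
      intro n
      induction n with
      | zero => simp [d, d0]
      | succ n ih => rw [hds, pow_succ, mul_comm, hnx1, ih]
    intro n k hk
    exact ((d n).2.1 hk).trans (this n).le
  refine ⟨fun t => ⋃ n, (d n).1 ⌊t * 2^n⌋₊, ?_, ?_, ?_, ?_⟩
  · intro s t hst
    refine Set.iUnion_mono fun n => (d n).2.1 (Nat.floor_mono ?_)
    have : (0:ℝ) < 2^n := by positivity
    nlinarith
  · intro t
    exact MeasurableSet.iUnion fun n => (d n).2.2 _
  · intro t ht
    refine Set.iUnion_subset fun n => htop n _ ?_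
    apply Nat.floor_le_of_le
    have : (0:ℝ) < 2^n := by positivity
    push_cast
    nlinarith [ht.2]
  · intro t ht m hm
    have := hfin m hm
    have hmon : Monotone (fun n => (d n).1 ⌊t * 2^n⌋₊) := by
      apply monotone_nat_of_le_succ
      intro n
      simp only [hds]
      rw [← hnx1 (d n)]
      apply (nx (d n)).2.1
      apply Nat.le_floor
      push_cast
      have := Nat.floor_le (show 0 ≤ t * 2^n by have := ht.1; positivity)
      rw [pow_succ]
      linarith
    have h1 : Filter.Tendsto (fun n => m.real ((d n).1 ⌊t * 2^n⌋₊)) Filter.atTop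
        (nhds (m.real (⋃ n, (d n).1 ⌊t * 2^n⌋₊))) :=
      (ENNReal.tendsto_toReal (measure_ne_top _ _)).comp
        (tendsto_measure_iUnion_atTop (μ := m) hmon)
    have h2 : Filter.Tendsto (fun n : ℕ => (⌊t * 2^n⌋₊ : ℝ) / 2^n * m.real A) Filter.atTop
        (nhds (t * m.real A)) :=
      ((tendsto_nat_floor_mul_div_atTop ht.1).comp
        (tendsto_pow_atTop_atTop_of_one_lt (by norm_num : (1:ℝ) < 2))).mul_const _
    refine tendsto_nhds_unique (h1.congr fun n => ?_) h2
    refine hval n _ ?_ m hm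
    apply Nat.floor_le_of_le
    have : (0:ℝ) < 2^n := by positivity
    push_cast
    nlinarith [ht.2]

lemma Halving.insert {S : Set (Measure Ω)} (hS : Halving S)
    (hfin : ∀ m ∈ S, IsFiniteMeasure m)
    (l : Measure Ω) (hl : l ∈ S) (n : Measure Ω) [IsFiniteMeasure n]
    (hn : ∀ E, MeasurableSet E → n.real E ≤ l.real E) : Halving (insert n S) := by
  intro A hA
  obtain ⟨c, hc1, hc2, hc3, hc4⟩ := hS.chain hfin A hA
  have := hfin l hl
  have m0 : (0:ℝ) ∈ Set.Icc (0:ℝ) 1 := by simp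
  have m1 : (1:ℝ) ∈ Set.Icc (0:ℝ) 1 := by simp
  have h0 : n.real (c 0) = 0 := by
    have h1 := hn _ (hc2 0)
    rw [hc4 0 m0 l hl] at h1
    have : 0 ≤ n.real (c 0) := measureReal_nonneg
    linarith
  have h1 : n.real (c 1) = n.real A := by
    have h1 := hn _ (hA.diff (hc2 1))
    rw [measureReal_sdiff (hc3 1 m1) (hc2 1), measureReal_sdiff (hc3 1 m1) (hc2 1),
      hc4 1 m1 l hl] at h1
    have : n.real (c 1) ≤ n.real A := measureReal_mono (hc3 1 m1)
    linarith
  have hlip : ∀ s ∈ Set.Icc (0:ℝ) 1, ∀ t ∈ Set.Icc (0:ℝ) 1, s ≤ t →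
      |n.real (c t) - n.real (c s)| ≤ (t - s) * l.real A := by
    intro s hs t ht hst
    have h := hn _ ((hc2 t).diff (hc2 s))
    rw [measureReal_sdiff (hc1 _ _ hst) (hc2 s), measureReal_sdiff (hc1 _ _ hst) (hc2 s),
      hc4 s hs l hl, hc4 t ht l hl] at h
    have : n.real (c s) ≤ n.real (c t) := measureReal_mono (hc1 _ _ hst)
    rw [abs_of_nonneg (by linarith)]
    linarith
  have hcont : ContinuousOn (fun t => n.real (c t)) (Set.Icc (0:ℝ) 1) := by
    have hL : LipschitzOnWith (Real.toNNReal (l.real A)) (fun t => n.real (c t))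
        (Set.Icc (0:ℝ) 1) := by
      apply LipschitzOnWith.of_dist_le_mul
      intro s hs t ht
      rw [Real.coe_toNNReal _ measureReal_nonneg, Real.dist_eq, Real.dist_eq]
      rcases le_total s t with h | h
      · rw [abs_sub_comm, abs_sub_comm s t, abs_of_nonneg (by linarith : 0 ≤ t - s), mul_comm]
        exact hlip s hs t ht h
      · rw [abs_of_nonneg (by linarith : 0 ≤ s - t), mul_comm]
        exact hlip t ht s hs h
    exact hL.continuousOn
  have hg : ContinuousOn (fun t => n.real (c (t + 1/2)) - n.real (c t))
      (Set.uIcc (0:ℝ) (1/2)) := by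
    rw [Set.uIcc_of_le (by norm_num)]
    refine ContinuousOn.sub (hcont.comp (by fun_prop) ?_) (hcont.mono ?_)
    · intro t ht
      constructor <;> linarith [ht.1, ht.2]
    · intro t ht
      constructor <;> linarith [ht.1, ht.2]
  have hivt := intermediate_value_uIcc hg
  have hmem : n.real A / 2 ∈ Set.uIcc (n.real (c (0 + 1/2)) - n.real (c 0))
      (n.real (c (1/2 + 1/2)) - n.real (c (1/2))) := by
    have e1 : (0:ℝ) + 1/2 = 1/2 := by norm_num
    have e2 : (1:ℝ)/2 + 1/2 = 1 := by norm_num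
    rw [e1, e2, h0, h1, Set.mem_uIcc]
    rcases le_total (n.real (c (1/2))) (n.real A / 2) with h | h
    · left; constructor <;> linarith
    · right; constructor <;> linarith
  obtain ⟨t, ht, hte⟩ := hivt hmem
  rw [Set.uIcc_of_le (by norm_num)] at ht
  have hle : t ≤ t + 1/2 := by linarith
  have ht1 : t ∈ Set.Icc (0:ℝ) 1 := by constructor <;> linarith [ht.1, ht.2]
  have ht2 : t + 1/2 ∈ Set.Icc (0:ℝ) 1 := by constructor <;> linarith [ht.1, ht.2]
  refine ⟨c (t+1/2) \ c t, (hc2 _).diff (hc2 _), Set.sdiff_subset.trans (hc3 _ ht2), ?_⟩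
  intro m hm
  rcases Set.mem_insert_iff.1 hm with rfl | hm
  · rw [measureReal_sdiff (hc1 _ _ hle) (hc2 t)]
    exact hte
  · have := hfin m hm
    rw [measureReal_sdiff (hc1 _ _ hle) (hc2 t), hc4 t ht1 m hm, hc4 _ ht2 m hm]
    ring

lemma belief_nonatomic_real {m : Measure Ω} (hm : IsBelief m) (E : Set Ω)
    (hE : MeasurableSet E) (h0 : 0 < m.real E) :
    ∃ F, MeasurableSet F ∧ F ⊆ E ∧ 0 < m.real F ∧ m.real F < m.real E := by
  have := hm.1
  obtain ⟨F, hF, hFE, h1, h2⟩ := hm.2 E hE (by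
    rw [pos_iff_ne_zero]; intro h; simp [Measure.real, h] at h0)
  refine ⟨F, hF, hFE, ?_, ?_⟩
  · exact ENNReal.toReal_pos h1.ne' (measure_ne_top _ _)
  · exact (ENNReal.toReal_lt_toReal (measure_ne_top _ _) (measure_ne_top _ _)).2 h2

lemma halving_three {a b c : Measure Ω} (ha : IsBelief a) (hb : IsBelief b) (hc : IsBelief c) :
    Halving ({a, b, c} : Set (Measure Ω)) := by
  have := ha.1
  have := hb.1
  have := hc.1
  have hsum : ∀ E, (a + b + c).real E = a.real E + b.real E + c.real E := by
    intro E
    rw [measureReal_add_apply, measureReal_add_apply]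
  have key : ∀ m : Measure Ω, IsBelief m → (∀ E, m.real E ≤ (a+b+c).real E) →
      ∀ E, MeasurableSet E → 0 < m.real E →
      ∃ F, MeasurableSet F ∧ F ⊆ E ∧ 0 < (a+b+c).real F ∧ (a+b+c).real F < (a+b+c).real E := by
    intro m hm hle E hE h0
    have := hm.1
    obtain ⟨F, hF, hFE, h1, h2⟩ := belief_nonatomic_real hm E hE h0
    refine ⟨F, hF, hFE, h1.trans_le (hle F), ?_⟩
    have h3 := hle (E \ F)
    rw [measureReal_sdiff hFE hF, measureReal_sdiff hFE hF] at h3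
    linarith
  have na : ∀ E, 0 ≤ a.real E := fun E => measureReal_nonneg
  have nb : ∀ E, 0 ≤ b.real E := fun E => measureReal_nonneg
  have nc : ∀ E, 0 ≤ c.real E := fun E => measureReal_nonneg
  have la : ∀ E, a.real E ≤ (a+b+c).real E := fun E => by
    rw [hsum]; linarith [na E, nb E, nc E]
  have lb : ∀ E, b.real E ≤ (a+b+c).real E := fun E => by
    rw [hsum]; linarith [na E, nb E, nc E]
  have lc : ∀ E, c.real E ≤ (a+b+c).real E := fun E => by
    rw [hsum]; linarith [na E, nb E, nc E]
  have hl : ∀ E, MeasurableSet E → 0 < (a+b+c).real E →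
      ∃ F, MeasurableSet F ∧ F ⊆ E ∧ 0 < (a+b+c).real F ∧
        (a+b+c).real F < (a+b+c).real E := by
    intro E hE h0
    rw [hsum] at h0
    rcases (na E).lt_or_eq with h | h
    · exact key a ha la E hE h
    rcases (nb E).lt_or_eq with h' | h'
    · exact key b hb lb E hE h'
    · exact key c hc lc E hE (by linarith)
  have H1 : Halving ({a+b+c} : Set (Measure Ω)) := by
    intro A hA
    obtain ⟨B, h1, h2, h3⟩ := sierpinski (a+b+c) hl A hA ((a+b+c).real A / 2)
      (by have : 0 ≤ (a+b+c).real A := measureReal_nonneg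
          linarith)
      (by have : 0 ≤ (a+b+c).real A := measureReal_nonneg
          linarith)
    refine ⟨B, h1, h2, fun m hm => ?_⟩
    rw [Set.mem_singleton_iff.1 hm, h3]
  have H2 := H1.insert (by rintro m rfl; infer_instance) (a+b+c) (by simp) c (fun E _ => lc E)
  have H3 := H2.insert (by rintro m (rfl | rfl) <;> infer_instance)
    (a+b+c) (by simp) b (fun E _ => lb E)
  have H4 := H3.insert (by rintro m (rfl | rfl | rfl) <;> infer_instance)
    (a+b+c) (by simp) a (fun E _ => la E)
  intro A hA
  obtain ⟨B, h1, h2, h3⟩ := H4 A hA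
  refine ⟨B, h1, h2, fun m hm => h3 m ?_⟩
  rcases hm with rfl | rfl | rfl <;> simp

lemma Halving.combo {S : Set (Measure Ω)} (hS : Halving S)
    (hprob : ∀ m ∈ S, IsProbabilityMeasure m) (A B : Set Ω) (hA : MeasurableSet A)
    (hB : MeasurableSet B) (x y z : ℝ) (hxyz : |x| + |y| + |z| ≤ 1/2) :
    ∃ E, MeasurableSet E ∧ ∀ m ∈ S,
      m.real E = 1/2 + y + x * m.real A + z * m.real B := by
  have hfin : ∀ m ∈ S, IsFiniteMeasure m := fun m hm => by
    have := hprob m hm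
    infer_instance
  have frac : ∀ D, MeasurableSet D → ∀ t, t ∈ Set.Icc (0:ℝ) 1 →
      ∃ F, MeasurableSet F ∧ F ⊆ D ∧ ∀ m ∈ S, m.real F = t * m.real D := by
    intro D hD t ht
    obtain ⟨c, h1, h2, h3, h4⟩ := hS.chain hfin D hD
    exact ⟨c t, h2 t, h3 t ht, h4 t ht⟩
  have bx := abs_le.1 (le_refl |x|)
  have bY := abs_le.1 (le_refl |y|)
  have bz := abs_le.1 (le_refl |z|)
  have px := abs_nonneg x
  have py := abs_nonneg y
  have pz := abs_nonneg z
  obtain ⟨F1, m1, s1, e1⟩ := frac (A ∩ B) (hA.inter hB) (1/2 + y + x + z)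
    (by constructor <;> linarith)
  obtain ⟨F2, m2, s2, e2⟩ := frac (A \ B) (hA.diff hB) (1/2 + y + x)
    (by constructor <;> linarith)
  obtain ⟨F3, m3, s3, e3⟩ := frac (B \ A) (hB.diff hA) (1/2 + y + z)
    (by constructor <;> linarith)
  obtain ⟨F4, m4, s4, e4⟩ := frac (A ∪ B)ᶜ (hA.union hB).compl (1/2 + y)
    (by constructor <;> linarith)
  refine ⟨((F1 ∪ F2) ∪ F3) ∪ F4, ((m1.union m2).union m3).union m4, fun m hm => ?_⟩
  have := hprob m hm
  have d12 : Disjoint F1 F2 := by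
    rw [Set.disjoint_left]; intro w h1 h2
    exact (s2 h2).2 (s1 h1).2
  have d3 : Disjoint (F1 ∪ F2) F3 := by
    rw [Set.disjoint_left]; rintro w (h1 | h1) h2
    · exact (s3 h2).2 (s1 h1).1
    · exact (s3 h2).2 (s2 h1).1
  have d4 : Disjoint ((F1 ∪ F2) ∪ F3) F4 := by
    rw [Set.disjoint_left]; rintro w ((h1 | h1) | h1) h2
    · exact (s4 h2) (Or.inl (s1 h1).1)
    · exact (s4 h2) (Or.inl (s2 h1).1)
    · exact (s4 h2) (Or.inr (s3 h1).1)
  rw [measureReal_union d4 m4, measureReal_union d3 m3, measureReal_union d12 m2,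
    e1 m hm, e2 m hm, e3 m hm, e4 m hm]
  have hA' : m.real (A ∩ B) + m.real (A \ B) = m.real A := measureReal_inter_add_sdiff hB
  have hB' : m.real (B ∩ A) + m.real (B \ A) = m.real B := measureReal_inter_add_sdiff hA
  have hC' : m.real (A ∪ B)ᶜ = 1 - m.real (A ∪ B) := probReal_compl_eq_one_sub (hA.union hB)
  have hU : m.real (A ∪ B) + m.real (A ∩ B) = m.real A + m.real B :=
    measureReal_union_add_inter hB
  rw [Set.inter_comm B A] at hB'
  rw [hC', ← hA', ← hB']
  rw [← hA', ← hB'] at hU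
  have hU' : m.real (A ∪ B) = m.real (A \ B) + m.real (A ∩ B) + m.real (B \ A) := by linarith
  rw [hU']
  ring

/-- A belief that is constant on the events of common probability `1/2` is an affine
combination. -/
lemma affine_of_const {a b c : Measure Ω} (ha : IsBelief a) (hb : IsBelief b) (hc : IsBelief c)
    (h : ∀ E E', MeasurableSet E → MeasurableSet E' → a.real E = 1/2 → b.real E = 1/2 →
      a.real E' = 1/2 → b.real E' = 1/2 → c.real E = c.real E') :
    ∃ t : ℝ, ∀ B, MeasurableSet B → c.real B = a.real B + t * (a.real B - b.real B) := by
  have H := halving_three ha hb hc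
  have hprob : ∀ m ∈ ({a, b, c} : Set (Measure Ω)), IsProbabilityMeasure m := by
    rintro m (rfl | rfl | rfl)
    exacts [ha.1, hb.1, hc.1]
  have lin : ∀ A B, MeasurableSet A → MeasurableSet B → ∀ x y z : ℝ,
      y + x * a.real A + z * a.real B = 0 → y + x * b.real A + z * b.real B = 0 →
      y + x * c.real A + z * c.real B = 0 := by
    intro A B hA hB x y z h1 h2
    set N : ℝ := 2 * (|x| + |y| + |z| + 1) with hN
    have hN0 : 0 < N := by positivity
    obtain ⟨E, hE, hEm⟩ := H.combo hprob A B hA hB (x/N) (y/N) (z/N) (by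
      rw [abs_div, abs_div, abs_div, abs_of_pos hN0, ← add_div, ← add_div, div_le_iff₀ hN0]
      linarith)
    obtain ⟨E', hE', hEm'⟩ := H.combo hprob A B hA hB 0 0 0 (by simp)
    have fact : ∀ m : Measure Ω, 1/2 + y/N + x/N * m.real A + z/N * m.real B
        = 1/2 + (y + x * m.real A + z * m.real B)/N := by
      intro m; ring
    have := h E E' hE hE' (by rw [hEm a (by simp), fact, h1]; simp)
      (by rw [hEm b (by simp), fact, h2]; simp) (by rw [hEm' a (by simp)]; simp)
      (by rw [hEm' b (by simp)]; simp)
    rw [hEm c (by simp), hEm' c (by simp), fact] at this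
    have h3 : (y + x * c.real A + z * c.real B)/N = 0 := by linarith
    rcases div_eq_zero_iff.1 h3 with h4 | h4
    · exact h4
    · exact absurd h4 hN0.ne'
  by_cases hab : ∃ A, MeasurableSet A ∧ a.real A ≠ b.real A
  · obtain ⟨A, hA, hne⟩ := hab
    have hD : a.real A - b.real A ≠ 0 := sub_ne_zero.2 hne
    refine ⟨(c.real A - a.real A) / (a.real A - b.real A), fun B hB => ?_⟩
    have := lin A B hA hB (-(a.real B - b.real B))
      ((a.real B - b.real B) * a.real A - (a.real A - b.real A) * a.real B)
      (a.real A - b.real A) (by ring) (by ring)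
    field_simp
    linarith
  · push Not at hab
    refine ⟨0, fun B hB => ?_⟩
    have := lin B B hB hB 0 (-a.real B) 1 (by ring) (by rw [hab B hB]; ring)
    linarith

open Classical in
/-- A binary act. -/
noncomputable def binAct (E : Set Ω) (hE : MeasurableSet E) (x y : O) : Act Ω O :=
  ⟨E.piecewise (fun _ => x) (fun _ => y),
    Measurable.piecewise hE measurable_const measurable_const⟩

lemma ev_binAct (m : Measure Ω) [IsProbabilityMeasure m] (u : O → ℝ) (E : Set Ω)
    (hE : MeasurableSet E) (x y : O) :
    ev m u (binAct E hE x y) = u x * m.real E + u y * (1 - m.real E) := by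
  classical
  have : (fun w => u ((binAct E hE x y).1 w)) = E.piecewise (fun _ => u x) (fun _ => u y) := by
    funext w
    by_cases h : w ∈ E <;> simp [binAct, h]
  unfold ev
  rw [this, integral_piecewise hE (by simp) (by simp)]
  simp [probReal_compl_eq_one_sub hE]
  ring

lemma map_binAct (m n : Measure Ω) [IsProbabilityMeasure m] [IsProbabilityMeasure n]
    (E : Set Ω) (hE : MeasurableSet E) (h : m.real E = n.real E) (x y : O) :
    Measure.map (binAct E hE x y).1 m = Measure.map (binAct E hE x y).1 n := by
  classical
  have h1 : m E = n E := by
    have := (ENNReal.toReal_eq_toReal_iff' (measure_ne_top m E) (measure_ne_top n E)).1 h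
    exact this
  have h2 : m Eᶜ = n Eᶜ := by
    rw [prob_compl_eq_one_sub hE, prob_compl_eq_one_sub hE, h1]
  ext T hT
  rw [Measure.map_apply (binAct E hE x y).2 hT, Measure.map_apply (binAct E hE x y).2 hT]
  have : (binAct E hE x y).1 ⁻¹' T = ((if x ∈ T then E else ∅) ∪ (if y ∈ T then Eᶜ else ∅)) := by
    ext w
    by_cases hw : w ∈ E <;> by_cases hx : x ∈ T <;> by_cases hy : y ∈ T <;>
      simp [binAct, hw, hx, hy]
  rw [this]
  split_ifs <;> simp [h1, h2]

variable {I : Type*}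

lemma social_belief (Φ : (I → Pref Ω O) → Pref Ω O) (hmono : RestrictedMonotonicity Φ)
    (p : I → Pref Ω O) (hp : IsProfile p) (i : I) (a b c : Measure Ω)
    (ha : RepresentsBelief a (p i)) (hb : RepresentsBelief b (Φ (updIndiff p i)))
    (hc : RepresentsBelief c (Φ p)) (hn : ¬ CompletelyIndifferent (Φ p)) :
    ∃ t : ℝ, ∀ B, MeasurableSet B → c.real B = a.real B + t * (a.real B - b.real B) := by
  refine affine_of_const ha.1 hb.1 hc.1 ?_
  intro E E' hE hE' h1 h2 h3 h4
  obtain ⟨ba, ua, _, ra⟩ := ha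
  obtain ⟨bb, ub, _, rb⟩ := hb
  obtain ⟨bc, uc, _, rc⟩ := hc
  have := ba.1
  have := bb.1
  have := bc.1
  obtain ⟨x, y, hxy⟩ : ∃ x y, uc x ≠ uc y := by
    by_contra hcon
    push Not at hcon
    apply hn
    intro f g
    rw [rc]
    apply le_of_eq
    unfold ev
    congr 1
    funext w
    exact hcon _ _
  have key : ∀ F F' (hF : MeasurableSet F) (hF' : MeasurableSet F'), a.real F = 1/2 →
      b.real F = 1/2 → a.real F' = 1/2 → b.real F' = 1/2 →
      Φ p (binAct F hF x y) (binAct F' hF' x y) := by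
    intro F F' hF hF' k1 k2 k3 k4
    refine (hmono i p hp b a ⟨bb, ub, ‹_›, rb⟩ ⟨ba, ua, ‹_›, ra⟩ _ _ ?_ ?_ ?_ ?_).1 ?_
    · rw [rb, ev_binAct, ev_binAct, k2, k4]
    · rw [rb, ev_binAct, ev_binAct, k2, k4]
    · exact map_binAct b a F hF (by rw [k1, k2]) x y
    · exact map_binAct b a F' hF' (by rw [k3, k4]) x y
    · rw [ra, ev_binAct, ev_binAct, k1, k3]
  have q1 := key E E' hE hE' h1 h2 h3 h4
  have q2 := key E' E hE' hE h3 h4 h1 h2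
  rw [rc, ev_binAct, ev_binAct] at q1 q2
  have q : (uc x - uc y) * (c.real E - c.real E') = 0 := by linarith
  rcases mul_eq_zero.1 q with h | h
  · exact absurd (sub_eq_zero.1 h) hxy
  · linarith

lemma not_span (J : Finset I) (πa : I → Measure Ω) (hdim : BeliefDimAtLeast 3 J πa)
    (m n : Measure Ω) :
    ∃ k ∈ J, ¬ ∃ x y : ℝ, ∀ E, MeasurableSet E →
      (πa k).real E = x * m.real E + y * n.real E := by
  by_contra hcon
  push Not at hcon
  obtain ⟨E, hE, hlin⟩ := hdim
  let L : (Fin 3 → ℝ) →ₗ[ℝ] (Fin 2 → ℝ) :=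
    Matrix.toLin' (Matrix.of ![fun k => m.real (E k), fun k => n.real (E k)])
  have hker : LinearMap.ker L ≠ ⊥ := LinearMap.ker_ne_bot_of_finrank_lt (by simp)
  obtain ⟨c, hc, hc0⟩ := Submodule.exists_mem_ne_zero_of_ne_bot hker
  apply hc0
  funext k
  refine hlin c ?_ k
  intro i hi
  obtain ⟨x, y, hxy⟩ := hcon i hi
  have hc' : L c = 0 := hc
  have e1 : ∑ k, m.real (E k) * c k = 0 := by
    have := congrFun hc' 0
    simpa [L, Matrix.mulVec, dotProduct] using this
  have e2 : ∑ k, n.real (E k) * c k = 0 := by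
    have := congrFun hc' 1
    simpa [L, Matrix.mulVec, dotProduct] using this
  calc ∑ k, c k * ((πa i) (E k)).toReal
      = ∑ k, (x * (m.real (E k) * c k) + y * (n.real (E k) * c k)) := by
        refine Finset.sum_congr rfl fun k _ => ?_
        have := hxy (E k) (hE k)
        rw [Measure.real] at this
        rw [this]; ring
    _ = 0 := by rw [Finset.sum_add_distrib, ← Finset.mul_sum, ← Finset.mul_sum, e1, e2]; simp

end Helpers

theorem stmt2 {Ω O I : Type*} [mΩ : MeasurableSpace Ω] [mO : MeasurableSpace O]
    [Fintype I] (hO : 4 ≤ Cardinal.mk O) (hI : 3 ≤ Fintype.card I)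
    (Φ : (I → Pref Ω O) → Pref Ω O)
    (hSWF : ∀ p : I → Pref Ω O, IsProfile p → IsSEU (Φ p))
    (hmono : RestrictedMonotonicity Φ)
    (hnbi : NoBeliefImposition Φ)
    (p : I → Pref Ω O) (hp : IsProfile p)
    (πa : I → Measure Ω) (ua : I → O → ℝ)
    (hrep : ∀ i, NormRep (πa i) (ua i) (p i))
    (hnotCI : ¬ CompletelyIndifferent (Φ p))
    (hdim : BeliefDimAtLeast 3 (concerned p) πa) :
    ∃ i ∈ concerned p, ∃ j ∈ concerned p, i ≠ j ∧
      ∃ πsij : Measure Ω, RepresentsBelief πsij (Φ (updIndiffPair p i j)) ∧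
        ∀ c0 ci cj : ℝ, c0 + ci + cj = 0 →
          (∀ E : Set Ω, MeasurableSet E →
            c0 * (πsij E).toReal + ci * (πa i E).toReal + cj * (πa j E).toReal = 0) →
          c0 = 0 ∧ ci = 0 ∧ cj = 0 := by
  classical
  by_contra hcon
  push Not at hcon
  have hra : ∀ i, RepresentsBelief (πa i) (p i) := by
    intro i
    obtain ⟨h1, h2, h3⟩ := hrep i
    refine ⟨h1, ua i, ?_, h3⟩
    rcases h2 with h2 | h2
    · refine ⟨h2.1, 1, fun x => ?_⟩
      have l0 := h2.2.1.1 ⟨x, rfl⟩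
      have l1 := h2.2.2.1 ⟨x, rfl⟩
      rw [abs_of_nonneg l0]
      exact l1
    · rw [h2]
      exact ⟨measurable_const, 0, fun x => by simp⟩
  have hci : ∀ (m : Measure Ω) (r : Pref Ω O), IsBelief m → CompletelyIndifferent r →
      RepresentsBelief m r := by
    intro m r hm hr
    refine ⟨hm, 0, ⟨measurable_const, 0, fun x => by simp⟩, fun f g => ?_⟩
    simp [ev, hr f g]
  have hprof : ∀ q : I → Pref Ω O, IsProfile q → ∀ i, IsProfile (updIndiff q i) := by
    intro q hq i j
    unfold updIndiff
    split_ifs with h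
    · obtain ⟨h1, u, h2, h3⟩ := hci (πa i) (indiffRel : Pref Ω O) (hrep i).1
        (fun _ _ => trivial)
      exact ⟨_, u, h1, h2, h3⟩
    · exact hq j
  have hrb : ∀ q : I → Pref Ω O, IsProfile q → ∃ m, RepresentsBelief m (Φ q) := by
    intro q hq
    obtain ⟨m, u, h1, h2, h3⟩ := hSWF q hq
    exact ⟨m, h1, u, h2, h3⟩
  have hone : ∀ i, (πa i).real Set.univ = 1 := fun i => by
    have := (hrep i).1.1
    simp
  obtain ⟨π, hπ⟩ := hrb p hp
  obtain ⟨i, hi, hiπ⟩ := not_span _ πa hdim π π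
  apply hiπ
  suffices hs : ∃ m, RepresentsBelief m (Φ (updIndiff p i)) ∧
      ∀ E, MeasurableSet E → m.real E = (πa i).real E by
    obtain ⟨m, hm, hme⟩ := hs
    obtain ⟨t, ht⟩ := social_belief Φ hmono p hp i (πa i) m π (hra i) hm hπ hnotCI
    refine ⟨1, 0, fun E hE => ?_⟩
    rw [ht E hE, hme E hE]
    ring
  by_cases hCI : CompletelyIndifferent (Φ (updIndiff p i))
  · exact ⟨πa i, hci _ _ (hrep i).1 hCI, fun _ _ => rfl⟩
  obtain ⟨m, hm⟩ := hrb _ (hprof p hp i)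
  refine ⟨m, hm, ?_⟩
  have hmone : m.real Set.univ = 1 := by
    have := hm.1.1
    simp
  have claim : ∀ l ∈ concerned p, (¬ ∃ x y : ℝ, ∀ E, MeasurableSet E →
      (πa l).real E = x * (πa i).real E + y * (πa i).real E) →
      ∃ x y : ℝ, ∀ E, MeasurableSet E → m.real E = x * (πa i).real E + y * (πa l).real E := by
    intro l hl hli
    have hne : i ≠ l := by
      rintro rfl
      exact hli ⟨1, 0, fun E _ => by ring⟩
    obtain ⟨n, hn⟩ := hrb _ (hprof _ (hprof p hp i) l)
    have hpl : updIndiff p i l = p l := by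
      unfold updIndiff
      rw [if_neg hne.symm]
    obtain ⟨t, ht⟩ := social_belief Φ hmono (updIndiff p i) (hprof p hp i) l (πa l) n m
      (by rw [hpl]; exact hra l) hn hm hCI
    obtain ⟨c0, ci, cl, hsum, hE, hne0⟩ := hcon i hi l hl hne n hn
    have hc0 : c0 ≠ 0 := by
      intro h0
      have hcl : cl ≠ 0 := by
        intro h1
        exact hne0 h0 (by linarith) h1
      apply hli
      refine ⟨1, 0, fun E hEm => ?_⟩
      have h2 := hE E hEm
      have hci' : ci = -cl := by linarith
      rw [h0, hci'] at h2
      have h3 : cl * ((πa l).real E - (πa i).real E) = 0 := by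
        simp only [Measure.real]; linarith
      rcases mul_eq_zero.1 h3 with h | h
      · exact absurd h hcl
      · linarith
    refine ⟨t * ci / c0, 1 + t + t * cl / c0, fun E hEm => ?_⟩
    have h2 : c0 * n.real E + ci * (πa i).real E + cl * (πa l).real E = 0 := hE E hEm
    rw [ht E hEm]
    have h3 : n.real E = (- ci * (πa i).real E - cl * (πa l).real E) / c0 := by
      rw [eq_div_iff hc0]; linarith
    rw [h3]
    field_simp
    ring
  obtain ⟨j, hj, hji⟩ := not_span _ πa hdim (πa i) (πa i)
  obtain ⟨k, hk, hkij⟩ := not_span _ πa hdim (πa i) (πa j)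
  obtain ⟨x, y, hxy⟩ := claim j hj hji
  obtain ⟨x', y', hxy'⟩ := claim k hk (by
    rintro ⟨s, t, hst⟩
    exact hkij ⟨s + t, 0, fun E hE => by rw [hst E hE]; ring⟩)
  have hy' : y' = 0 := by
    by_contra hy
    apply hkij
    refine ⟨(x - x') / y', y / y', fun E hE => ?_⟩
    have h1 := hxy E hE
    have h2 := hxy' E hE
    field_simp
    linarith
  have hx' : x' = 1 := by
    have := hxy' _ MeasurableSet.univ
    rw [hy', hmone, hone, hone] at this
    linarith
  intro E hE
  rw [hxy' E hE, hy', hx']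
  ring
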